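/- Let 0 < θ₀ < π and 0 < λ < 1, and define f(t) = Λ(t) + Λ(θ₀ − λt) + Λ(π − θ₀ − (1−λ)t) for t ≥ 0. Then the difference quotient (f(t) − f(0))/t tends to +∞ as t → 0⁺; that is, the one-sided derivative of f at 0 is +∞. -/

import Mathlib

open Real

/-- The Lobachevsky function `Λ(x) = -∫₀ˣ log |2 sin t| dt`. -/
noncomputable def lob (x : ℝ) : ℝ := -∫ t in (0:ℝ)..x, Real.log |2 * Real.sin t|

open Filter Topology Set

theorem intervalIntegrable_log_abs_two_mul_sin (a b : ℝ) :
    IntervalIntegrable (fun t => Real.log |2 * Real.sin t|) MeasureTheory.volume a b := by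
  have h : AnalyticOnNhd ℝ (fun t : ℝ => 2 * Real.sin t) (uIcc a b) :=
    fun x _ => analyticAt_const.mul Real.analyticAt_sin
  exact h.meromorphicOn.intervalIntegrable_log_norm

theorem lob_zero : lob 0 = 0 := by simp [lob]

/-- Away from the zeros of the sine, `Λ' = -log |2 sin|`. -/
theorem hasDerivAt_lob {x : ℝ} (hx : Real.sin x ≠ 0) :
    HasDerivAt lob (-Real.log |2 * Real.sin x|) x := by
  have hc : ContinuousAt (fun t => Real.log |2 * Real.sin t|) x :=
    ContinuousAt.log (by fun_prop) (by simpa using hx)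
  exact (intervalIntegral.integral_hasDerivAt_right
    (intervalIntegrable_log_abs_two_mul_sin 0 x)
    (Measurable.stronglyMeasurable (by fun_prop)).stronglyMeasurableAtFilter hc).neg

/-- Since `sin s ≤ s ≤ t` on `(0, t]`, the integrand is at most `log (2 t)`. -/
theorem neg_log_two_mul_le_lob_div {t : ℝ} (ht : 0 < t) (htπ : t < π) :
    -Real.log (2 * t) ≤ lob t / t := by
  have h : ∫ s in (0:ℝ)..t, Real.log |2 * Real.sin s| ≤ ∫ _ in (0:ℝ)..t, Real.log (2 * t) := by
    refine intervalIntegral.integral_mono_on_of_le_Ioo ht.le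
      (intervalIntegrable_log_abs_two_mul_sin 0 t) intervalIntegrable_const fun s hs => ?_
    have hpos : 0 < Real.sin s := Real.sin_pos_of_pos_of_lt_pi hs.1 (hs.2.trans htπ)
    rw [abs_of_pos (by positivity)]
    refine Real.log_le_log (by positivity) ?_
    linarith [Real.sin_le hs.1.le, hs.2]
  rw [intervalIntegral.integral_const, smul_eq_mul] at h
  rw [le_div_iff₀ ht, lob]
  linarith

theorem tendsto_lob_div_atTop : Tendsto (fun t => lob t / t) (𝓝[>] 0) atTop := by
  have hlog : Tendsto (fun t : ℝ => -Real.log (2 * t)) (𝓝[>] 0) atTop := by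
    refine tendsto_neg_atBot_atTop.comp (Real.tendsto_log_nhdsGT_zero.comp ?_)
    refine tendsto_nhdsWithin_iff.2 ⟨?_, ?_⟩
    · exact (Continuous.tendsto' (by fun_prop) 0 0 (by simp)).mono_left nhdsWithin_le_nhds
    · filter_upwards [self_mem_nhdsWithin] with t ht
      exact mul_pos two_pos (mem_Ioi.1 ht)
  refine tendsto_atTop_mono' _ ?_ hlog
  filter_upwards [Ioo_mem_nhdsGT Real.pi_pos] with t ht
  exact neg_log_two_mul_le_lob_div ht.1 ht.2

/-- The difference quotient of `t ↦ Λ(x - c t)` converges when `sin x ≠ 0`. -/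
theorem tendsto_lob_sub_mul_sub_div {x : ℝ} (hx : Real.sin x ≠ 0) (c : ℝ) :
    Tendsto (fun t => (lob (x - c * t) - lob x) / t) (𝓝[>] 0)
      (𝓝 (c * Real.log |2 * Real.sin x|)) := by
  have hin : HasDerivAt (fun t : ℝ => x - c * t) (-c) 0 := by
    simpa using ((hasDerivAt_id (0 : ℝ)).const_mul c).const_sub x
  have hout : HasDerivAt lob (-Real.log |2 * Real.sin x|) (x - c * 0) := by
    simpa using hasDerivAt_lob hx
  have h := (hout.comp (0 : ℝ) hin).tendsto_slope_zero_right
  simpa [div_eq_inv_mul, mul_comm c] using h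



/-- Opening up the solitary zero angle of the degenerate triple `(0, θ₀, π−θ₀)` increases
volume at infinite initial rate: with `f(t) = Λ(t) + Λ(θ₀−λt) + Λ(π−θ₀−(1−λ)t)`, the
difference quotient `(f(t) − f(0))/t` tends to `+∞` as `t → 0⁺`. -/
theorem infinite_one_sided_derivative (θ₀ l : ℝ)
    (hθ₀ : 0 < θ₀) (hθ₀' : θ₀ < π) (hl : 0 < l) (hl' : l < 1) :
    Filter.Tendsto
      (fun t : ℝ =>
        ((lob t + lob (θ₀ - l * t) + lob (π - θ₀ - (1 - l) * t)) -
          (lob 0 + lob θ₀ + lob (π - θ₀))) / t)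
      (nhdsWithin 0 (Set.Ioi 0)) Filter.atTop := by
  have hsin : Real.sin θ₀ ≠ 0 := (Real.sin_pos_of_pos_of_lt_pi hθ₀ hθ₀').ne'
  have hsin' : Real.sin (π - θ₀) ≠ 0 := by rwa [Real.sin_pi_sub]
  refine ((tendsto_lob_div_atTop.atTop_add (tendsto_lob_sub_mul_sub_div hsin l)).atTop_add
    (tendsto_lob_sub_mul_sub_div hsin' (1 - l))).congr fun t => ?_
  rw [lob_zero]
  ring
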